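/- Let f : E → ℝ be differentiable, convex, and L-smooth with L > 0. Then f is co-coercive: for all x, y ∈ E, ⟨∇f(x) − ∇f(y), x − y⟩ ≥ (1/L)·‖∇f(x) − ∇f(y)‖². -/

import Mathlib

open RealInnerProductSpace

section

variable {E : Type*} [NormedAddCommGroup E] [InnerProductSpace ℝ E] [CompleteSpace E] {f : E → ℝ}

/-- The derivative of a differentiable function along a line. -/
theorem hasDerivAt_comp_line_gradient (hf : Differentiable ℝ f) (x d : E) (t : ℝ) :
    HasDerivAt (fun s : ℝ => f (x + s • d)) ⟪gradient f (x + t • d), d⟫ t := by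
  have hline : HasDerivAt (fun s : ℝ => x + s • d) d t := by
    simpa using ((hasDerivAt_id t).smul_const d).const_add x
  simpa [Function.comp_def] using
    (hf (x + t • d)).hasGradientAt.hasFDerivAt.comp_hasDerivAt t hline

/-- A differentiable convex function lies above its tangent hyperplanes. -/
theorem ConvexOn.add_inner_gradient_le (hconv : ConvexOn ℝ Set.univ f)
    (hf : Differentiable ℝ f) (x d : E) : f x + ⟪gradient f x, d⟫ ≤ f (x + d) := by
  have hline : ConvexOn ℝ Set.univ (fun s : ℝ => f (x + s • d)) := by
    simpa [Function.comp_def, AffineMap.lineMap_apply, add_comm] using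
      hconv.comp_affineMap (AffineMap.lineMap x (x + d) : ℝ →ᵃ[ℝ] E)
  have hslope := hline.le_slope_of_hasDerivAt (Set.mem_univ 0) (Set.mem_univ 1) one_pos
    (hasDerivAt_comp_line_gradient hf x d 0)
  simp only [slope_def_field, zero_smul, add_zero, one_smul, sub_zero, div_one] at hslope
  linarith

/-- The descent lemma: the quadratic upper bound for a function with Lipschitz gradient. -/
theorem le_add_inner_gradient_add_of_lipschitz {L : ℝ} (hf : Differentiable ℝ f)
    (hsmooth : ∀ x y : E, ‖gradient f x - gradient f y‖ ≤ L * ‖x - y‖) (x d : E) :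
    f (x + d) ≤ f x + ⟪gradient f x, d⟫ + L / 2 * ‖d‖ ^ 2 := by
  let g : ℝ → ℝ := fun t => f (x + t • d) - (t * ⟪gradient f x, d⟫ + t ^ 2 * (L / 2 * ‖d‖ ^ 2))
  have hderiv (t : ℝ) : HasDerivAt g (⟪gradient f (x + t • d), d⟫ -
      (⟪gradient f x, d⟫ + 2 * t * (L / 2 * ‖d‖ ^ 2))) t := by
    refine (hasDerivAt_comp_line_gradient hf x d t).sub (HasDerivAt.add ?_ ?_)
    · simpa using (hasDerivAt_id t).mul_const ⟪gradient f x, d⟫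
    · simpa using (hasDerivAt_pow 2 t).mul_const (L / 2 * ‖d‖ ^ 2)
  have hanti : AntitoneOn g (Set.Ici 0) := by
    refine antitoneOn_of_deriv_nonpos (convex_Ici 0)
      (fun t _ => (hderiv t).continuousAt.continuousWithinAt)
      (fun t _ => (hderiv t).differentiableAt.differentiableWithinAt) fun t ht => ?_
    rw [interior_Ici, Set.mem_Ioi] at ht
    have hbound : ⟪gradient f (x + t • d) - gradient f x, d⟫ ≤ L * (t * ‖d‖) * ‖d‖ := by
      refine (real_inner_le_norm _ _).trans ?_
      gcongr
      simpa [norm_smul, abs_of_pos ht] using hsmooth (x + t • d) x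
    rw [inner_sub_left] at hbound
    rw [(hderiv t).deriv]
    linarith
  have h := hanti (Set.mem_Ici.2 le_rfl) (Set.mem_Ici.2 zero_le_one) zero_le_one
  simp only [g, zero_smul, one_smul, add_zero] at h
  linarith

/-- The tangent lower bound for a smooth convex function, sharpened by the gradient gap. -/
theorem ConvexOn.add_inner_gradient_add_norm_sq_le {L : ℝ} (hL : 0 < L)
    (hconv : ConvexOn ℝ Set.univ f) (hf : Differentiable ℝ f)
    (hsmooth : ∀ x y : E, ‖gradient f x - gradient f y‖ ≤ L * ‖x - y‖) (x y : E) :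
    f x + ⟪gradient f x, y - x⟫ + 1 / (2 * L) * ‖gradient f x - gradient f y‖ ^ 2 ≤ f y := by
  set u := gradient f x - gradient f y with hu
  have hlower := hconv.add_inner_gradient_le hf x (y - x + L⁻¹ • u)
  have hupper := le_add_inner_gradient_add_of_lipschitz hf hsmooth y (L⁻¹ • u)
  rw [show x + (y - x + L⁻¹ • u) = y + L⁻¹ • u by abel, inner_add_right] at hlower
  have hgap : ⟪gradient f x, L⁻¹ • u⟫ - ⟪gradient f y, L⁻¹ • u⟫ = L⁻¹ * ‖u‖ ^ 2 := by
    rw [← inner_sub_left, ← hu, real_inner_smul_right, real_inner_self_eq_norm_sq]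
  have hquad : L / 2 * ‖L⁻¹ • u‖ ^ 2 = L⁻¹ * ‖u‖ ^ 2 - 1 / (2 * L) * ‖u‖ ^ 2 := by
    rw [norm_smul, Real.norm_of_nonneg (inv_nonneg.2 hL.le)]
    field_simp
    ring
  linarith

end

/-- Co-coercivity: if `f : E → ℝ` is differentiable, convex, and `L`-smooth with `L > 0`,
then `⟪∇f x − ∇f y, x − y⟫ ≥ (1/L) ‖∇f x − ∇f y‖²` for all `x y`. -/
theorem smooth_convex_cocoercive {E : Type*} [NormedAddCommGroup E]
    [InnerProductSpace ℝ E] [CompleteSpace E]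
    (f : E → ℝ) (L : ℝ) (hL : 0 < L)
    (hdiff : Differentiable ℝ f)
    (hconv : ConvexOn ℝ Set.univ f)
    (hsmooth : ∀ x y : E, ‖gradient f x - gradient f y‖ ≤ L * ‖x - y‖) :
    ∀ x y : E, ⟪gradient f x - gradient f y, x - y⟫ ≥
      (1 / L) * ‖gradient f x - gradient f y‖ ^ 2 := by
  intro x y
  have hxy := hconv.add_inner_gradient_add_norm_sq_le hL hdiff hsmooth x y
  have hyx := hconv.add_inner_gradient_add_norm_sq_le hL hdiff hsmooth y x
  rw [norm_sub_rev (gradient f y)] at hyx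
  rw [← neg_sub x y, inner_neg_right] at hxy
  have hhalf : 1 / L = 1 / (2 * L) + 1 / (2 * L) := by
    field_simp
    norm_num
  rw [inner_sub_left, hhalf, add_mul]
  linarith
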